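/- Let R = ℤ[s, s⁻¹] and define V₁ = s⁻³·(-1 + s² - 2s⁴ + s⁶ - 2s⁸ + s¹⁰) and V_a = s⁴·V_{a-1} + (s³ - s)·(s⁻⁴ + 2 + s⁴) for a ≥ 2. Then for every a ≥ 1, V_a ≠ -s - s⁻¹. (Since -s - s⁻¹ = -t^{1/2} - t^{-1/2} is the Jones polynomial of the two-component unlink, this shows that the link P_a is not the unlink for any a ≥ 1.) -/

import Mathlib

open LaurentPolynomial

/-- The Jones polynomial of the Whitehead link `P₁`, in the variable `s = t^{1/2}`:
`V₁ = s⁻³·(-1 + s² - 2s⁴ + s⁶ - 2s⁸ + s¹⁰)`. -/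
noncomputable def V₁ : LaurentPolynomial ℤ :=
  T (-3) * (-1 + T 2 - 2 * T 4 + T 6 - 2 * T 8 + T 10)

/-- The Jones polynomial of the chain mail link `C₃`, in the variable `s = t^{1/2}`:
`C₃ = s⁻⁴ + 2 + s⁴`. -/
noncomputable def C₃ : LaurentPolynomial ℤ := T (-4) + 2 + T 4

/-- The Jones polynomials `V_a` of the links `P_a`, in the variable `s = t^{1/2}`,
defined by `V_1 = V₁` and the skein recursion `V_a = s⁴·V_{a-1} + (s³ - s)·C₃`
for `a ≥ 2`.  (The value at `a = 0` is irrelevant and set to `0`.) -/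
noncomputable def V : ℕ → LaurentPolynomial ℤ
  | 0 => 0
  | 1 => V₁
  | (a + 2) => T 4 * V (a + 1) + (T 3 - T 1) * C₃

open Polynomial in
/-- For `a ≥ 1`, `s³ · V_a` is an ordinary polynomial in `s` with constant term `-1`. -/
theorem exists_polynomial_V_succ (a : ℕ) :
    ∃ p : ℤ[X], V (a + 1) = T (-3) * p.toLaurent ∧ p.coeff 0 = -1 := by
  induction a with
  | zero =>
    refine ⟨-1 + X ^ 2 - 2 * X ^ 4 + X ^ 6 - 2 * X ^ 8 + X ^ 10, ?_, ?_⟩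
    · simp [V, V₁, map_ofNat toLaurent]
    · simp [coeff_zero_eq_eval_zero]
  | succ a ih =>
    obtain ⟨p, hV, -⟩ := ih
    refine ⟨X ^ 4 * p + (X ^ 2 - 1) * (1 + 2 * X ^ 4 + X ^ 8), ?_, ?_⟩
    · have h3 : (T 3 : LaurentPolynomial ℤ) = T 1 * T 2 := by rw [← T_add]; norm_num
      have h1 : (T (-3) : LaurentPolynomial ℤ) = T 1 * T (-4) := by rw [← T_add]; norm_num
      have h4 : (T (-4) * T 4 : LaurentPolynomial ℤ) = 1 := by rw [← T_add]; simp
      have h8 : (T 8 : LaurentPolynomial ℤ) = T 4 * T 4 := by rw [← T_add]; norm_num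
      simp only [V, hV, C₃, map_add, map_mul, map_sub, map_one, map_ofNat, toLaurent_X_pow,
        Nat.cast_ofNat]
      rw [h3, h1, h8]
      linear_combination (-(T 1 * (T 2 - 1) * (2 + T 4)) : LaurentPolynomial ℤ) * h4
    · simp [coeff_zero_eq_eval_zero]

/-- For every `a ≥ 1`, `V_a ≠ -s - s⁻¹`.  Since `-s - s⁻¹ = -t^{1/2} - t^{-1/2}` is the
Jones polynomial of the two-component unlink, the link `P_a` is not the unlink. -/
theorem V_ne_unlink (a : ℕ) (ha : 1 ≤ a) :
    V a ≠ -T 1 - T (-1) := by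
  obtain ⟨b, rfl⟩ := Nat.exists_eq_add_of_le' ha
  obtain ⟨p, hV, hp⟩ := exists_polynomial_V_succ b
  intro h
  have hU : (-T 1 - T (-1) : LaurentPolynomial ℤ) =
      T (-3) * (-Polynomial.X ^ 4 - Polynomial.X ^ 2 : Polynomial ℤ).toLaurent := by
    simp only [map_sub, map_neg, Polynomial.toLaurent_X_pow, mul_sub, mul_neg, ← T_add]
    norm_num
  rw [hV, hU] at h
  have hpU := Polynomial.toLaurent_injective ((isUnit_T (-3)).mul_left_cancel h)
  simp [hpU, Polynomial.coeff_zero_eq_eval_zero] at hp
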